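/- arXiv:2501.07466 — 2 statements merged into one kernel-verified Lean document; each statement's English description precedes it below -/
import Mathlib

section
/- There exist C>0 and a positive integer K such that for every integer k≥K, the set Σ ∩ [(k+1/2)π − 1, (k+1/2)π + 1] consists of exactly one point m_k, and this point satisfies |m_k − (k+1/2)π| ≤ C/k. In particular, the large elements of Σ are of the form (k+1/2)π + O(1/k). -/
noncomputable section

/-- The dispersion relation θ(ξ; m). -/
def theta (m ξ : ℝ) : ℝ :=
  Real.arctan (ξ * Real.sin (Real.sqrt (m ^ 2 + ξ ^ 2)) /
    Real.sqrt (m ^ 2 + ξ ^ 2 * Real.cos (Real.sqrt (m ^ 2 + ξ ^ 2)) ^ 2))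

/-- The exceptional mass set Σ. -/
def SigmaSet : Set ℝ := {m | 0 < m ∧ iteratedDeriv 3 (theta m) 0 = 0}

open Filter Topology

lemma tendsto_sq_nhds_zero : Tendsto (fun x : ℝ => x ^ 2) (𝓝 0) (𝓝 0) := by
  have h : Continuous fun x : ℝ => x ^ 2 := by fun_prop
  simpa using h.tendsto 0

lemma deriv_deriv_comp_sq {H : ℝ → ℝ} (hH : ContDiffAt ℝ 2 H 0) :
    deriv (deriv fun x => H (x ^ 2)) 0 = 2 * deriv H 0 := by
  have hev : ∀ᶠ u in 𝓝 (0 : ℝ), ContDiffAt ℝ 2 H u := hH.eventually (by simp)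
  have h1 : deriv (fun x => H (x ^ 2)) =ᶠ[𝓝 0] fun x => deriv H (x ^ 2) * (2 * x) := by
    filter_upwards [tendsto_sq_nhds_zero.eventually hev] with x hx
    have hd := (hx.differentiableAt (by norm_num)).hasDerivAt
    have hs : HasDerivAt (fun y : ℝ => y ^ 2) (2 * x) x := by simpa using hasDerivAt_pow 2 x
    exact (HasDerivAt.comp (h := fun y => y ^ 2) x hd hs).deriv
  rw [h1.deriv_eq]
  have hc : ContDiffAt ℝ 1 (deriv H) 0 := hH.derivWithin (m := 1) (by norm_num)
  have hd : DifferentiableAt ℝ (fun x : ℝ => deriv H (x ^ 2)) 0 := by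
    have : DifferentiableAt ℝ (deriv H) ((0 : ℝ) ^ 2) := by
      simpa using hc.differentiableAt (by norm_num)
    exact DifferentiableAt.comp (f := fun y => y ^ 2) (0 : ℝ) this (by fun_prop)
  have hl : HasDerivAt (fun x : ℝ => 2 * x) 2 0 := by
    simpa using (hasDerivAt_id (0 : ℝ)).const_mul 2
  have := (hd.hasDerivAt.mul hl).deriv
  refine this.trans ?_
  simp [mul_comm]

lemma iteratedDeriv_three_arctan_mul_comp_sq {h : ℝ → ℝ} (hh : ContDiffAt ℝ 3 h 0) :
    iteratedDeriv 3 (fun x => Real.arctan (x * h (x ^ 2))) 0 =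
      6 * deriv h 0 - 2 * h 0 ^ 3 := by
  set H : ℝ → ℝ := fun u => (h u + 2 * u * deriv h u) / (1 + u * h u ^ 2) with hHdef
  have hc : ContDiffAt ℝ 2 (deriv h) 0 := hh.derivWithin (m := 2) (by norm_num)
  have hh2 : ContDiffAt ℝ 2 h 0 := hh.of_le (by norm_num)
  have hH : ContDiffAt ℝ 2 H 0 := by
    refine ContDiffAt.div (by fun_prop) (by fun_prop) (by simp)
  have hev : ∀ᶠ u in 𝓝 (0 : ℝ), ContDiffAt ℝ 3 h u := hh.eventually (by simp)
  have h1 : deriv (fun x => Real.arctan (x * h (x ^ 2))) =ᶠ[𝓝 0] fun x => H (x ^ 2) := by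
    filter_upwards [tendsto_sq_nhds_zero.eventually hev] with x hx
    have hd := (hx.differentiableAt (by norm_num)).hasDerivAt
    have hs : HasDerivAt (fun y : ℝ => y ^ 2) (2 * x) x := by simpa using hasDerivAt_pow 2 x
    have := ((hasDerivAt_id x).mul (HasDerivAt.comp (h := fun y => y ^ 2) x hd hs)).arctan.deriv
    refine this.trans ?_
    simp only [hHdef, Function.comp, id, Pi.mul_apply]
    have : (1 + x ^ 2 * h (x ^ 2) ^ 2) ≠ 0 := by positivity
    have : (1 + (x * h (x ^ 2)) ^ 2) ≠ 0 := by positivity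
    field_simp
  have hdH : deriv H 0 = 3 * deriv h 0 - h 0 ^ 3 := by
    have ha := (hh.differentiableAt (by norm_num)).hasDerivAt
    have hb := (hc.differentiableAt (by norm_num)).hasDerivAt
    have hi := hasDerivAt_id (0 : ℝ)
    have := ((ha.add ((hi.const_mul 2).mul hb)).div ((hi.mul (ha.pow 2)).const_add 1)
      (by simp)).deriv
    refine this.trans ?_
    simp
    ring
  rw [iteratedDeriv_succ, iteratedDeriv_succ, iteratedDeriv_one, h1.deriv.deriv_eq,
    deriv_deriv_comp_sq hH, hdH]
  ring

lemma iteratedDeriv_three_theta {m : ℝ} (hm : 0 < m) :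
    iteratedDeriv 3 (theta m) 0 =
      (3 * m * Real.cos m - 3 * Real.sin m + Real.sin m ^ 3) / m ^ 3 := by
  set w : ℝ → ℝ := fun u => Real.sqrt (m ^ 2 + u) with hw
  set q : ℝ → ℝ := fun u => Real.sqrt (m ^ 2 + u * Real.cos (w u) ^ 2) with hq
  have hw0 : w 0 = m := by simp [hw, Real.sqrt_sq hm.le]
  have hq0 : q 0 = m := by simp [hq, Real.sqrt_sq hm.le]
  have hwc : ContDiffAt ℝ 3 w 0 := ContDiffAt.sqrt (by fun_prop) (by simp [hm.ne'])
  have hqc : ContDiffAt ℝ 3 q 0 := ContDiffAt.sqrt (by fun_prop) (by simp [hm.ne'])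
  have hhc : ContDiffAt ℝ 3 (fun u => Real.sin (w u) / q u) 0 :=
    ContDiffAt.div (by fun_prop) hqc (by rw [hq0]; exact hm.ne')
  have hθ : theta m = fun x => Real.arctan (x * (fun u => Real.sin (w u) / q u) (x ^ 2)) := by
    funext x
    simp only [theta, hw, hq, mul_div_assoc]
  have hi := hasDerivAt_id (0 : ℝ)
  have hwd : HasDerivAt w (1 / (2 * m)) 0 := by
    have := (hi.const_add (m ^ 2)).sqrt (by simp [hm.ne'])
    simpa [Real.sqrt_sq hm.le] using this
  have hqd : HasDerivAt q (Real.cos m ^ 2 / (2 * m)) 0 := by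
    have := ((hi.mul (hwd.cos.pow 2)).const_add (m ^ 2)).sqrt (by simp [hm.ne'])
    simpa [Real.sqrt_sq hm.le, hw0] using this
  have hd := (hwd.sin.div hqd (by rw [hq0]; exact hm.ne')).deriv
  rw [hw0, hq0] at hd
  rw [hθ, iteratedDeriv_three_arctan_mul_comp_sq hhc]
  have hd' : deriv (fun u => Real.sin (w u) / q u) 0 = _ := hd
  rw [hd', hw0, hq0]
  field_simp
  linear_combination -6 * Real.sin m * Real.sin_sq_add_cos_sq m

lemma mem_SigmaSet_iff {m : ℝ} :
    m ∈ SigmaSet ↔ 0 < m ∧ 3 * m * Real.cos m - 3 * Real.sin m + Real.sin m ^ 3 = 0 := by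
  refine and_congr_right fun hm => ?_
  rw [iteratedDeriv_three_theta hm]
  simp [hm.ne']

lemma half_odd_pi_add_mem_SigmaSet_iff (k : ℕ) {t : ℝ}
    (hpos : 0 < ((k : ℝ) + 1 / 2) * Real.pi + t) :
    ((k : ℝ) + 1 / 2) * Real.pi + t ∈ SigmaSet ↔
      3 * (((k : ℝ) + 1 / 2) * Real.pi + t) * Real.sin t + 3 * Real.cos t - Real.cos t ^ 3
        = 0 := by
  rw [mem_SigmaSet_iff, and_iff_right hpos]
  have e : ((k : ℝ) + 1 / 2) * Real.pi + t = (t + Real.pi / 2) + k * Real.pi := by ring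
  have hc : Real.cos (((k : ℝ) + 1 / 2) * Real.pi + t) = (-1) ^ k * (-Real.sin t) := by
    rw [e, Real.cos_add_nat_mul_pi, Real.cos_add_pi_div_two]
  have hs : Real.sin (((k : ℝ) + 1 / 2) * Real.pi + t) = (-1) ^ k * Real.cos t := by
    rw [e, Real.sin_add_nat_mul_pi, Real.sin_add_pi_div_two]
  rw [hc, hs]
  rcases neg_one_pow_eq_or ℝ k with h | h <;> rw [h] <;> constructor <;> intro h' <;> linarith

lemma strictMonoOn_mul_sin_add_cos {a : ℝ} (ha : 2 < a) :
    StrictMonoOn (fun t => 3 * (a + t) * Real.sin t + 3 * Real.cos t - Real.cos t ^ 3)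
      (Set.Icc (-1) 1) := by
  refine strictMonoOn_of_deriv_pos (convex_Icc _ _) (by fun_prop) fun t ht => ?_
  rw [interior_Icc] at ht
  have hd : HasDerivAt
      (fun t => 3 * (a + t) * Real.sin t + 3 * Real.cos t - Real.cos t ^ 3)
      (3 * Real.cos t * (a + t + Real.cos t * Real.sin t)) t := by
    have := (((((hasDerivAt_id t).const_add a).const_mul 3).mul (Real.hasDerivAt_sin t)).add
      ((Real.hasDerivAt_cos t).const_mul 3)).sub ((Real.hasDerivAt_cos t).pow 3)
    refine this.congr_deriv ?_
    simp
    ring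
  rw [hd.deriv]
  have hpi := Real.pi_gt_three
  have hcos : 0 < Real.cos t :=
    Real.cos_pos_of_mem_Ioo ⟨by linarith [ht.1], by linarith [ht.2]⟩
  have hcs : -1 ≤ Real.cos t * Real.sin t := by
    nlinarith [Real.sin_sq_add_cos_sq t, sq_nonneg (Real.cos t + Real.sin t)]
  have : 0 < a + t + Real.cos t * Real.sin t := by linarith [ht.1]
  positivity

theorem SigmaSet_asymptotics :
    ∃ C > 0, ∃ K : ℕ, 0 < K ∧ ∀ k : ℕ, K ≤ k →
      ∃ mk : ℝ,
        SigmaSet ∩ Set.Icc (((k : ℝ) + 1 / 2) * Real.pi - 1) (((k : ℝ) + 1 / 2) * Real.pi + 1)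
          = {mk} ∧
        |mk - ((k : ℝ) + 1 / 2) * Real.pi| ≤ C / (k : ℝ) := by
  refine ⟨2, by norm_num, 2, by norm_num, fun k hk => ?_⟩
  have hk' : (2 : ℝ) ≤ k := by exact_mod_cast hk
  have hpi := Real.pi_gt_three
  have hpi4 := Real.pi_le_four
  have hiff := fun t => half_odd_pi_add_mem_SigmaSet_iff k (t := t)
  have ha : 3 * (k : ℝ) + 1 ≤ ((k : ℝ) + 1 / 2) * Real.pi := by nlinarith
  set a : ℝ := ((k : ℝ) + 1 / 2) * Real.pi
  set G : ℝ → ℝ := fun t => 3 * (a + t) * Real.sin t + 3 * Real.cos t - Real.cos t ^ 3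
    with hG
  have hmono : StrictMonoOn G (Set.Icc (-1) 1) := strictMonoOn_mul_sin_add_cos (by linarith)
  have hcont : ContinuousOn G (Set.Icc (-1) 0) := by fun_prop
  have hG0 : 0 ≤ G 0 := by norm_num [hG]
  have hG1 : G (-1) ≤ 0 := by
    have hs : 2 / Real.pi * 1 ≤ Real.sin 1 := Real.mul_le_sin (by norm_num) (by linarith)
    have hs' : 1 / 2 ≤ Real.sin 1 := by
      refine le_trans ?_ hs
      rw [mul_one, div_le_div_iff₀ (by norm_num) (by linarith)]
      linarith
    have hc : 0 ≤ Real.cos 1 := Real.cos_one_pos.le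
    simp only [hG, Real.sin_neg, Real.cos_neg]
    nlinarith [Real.cos_le_one 1, pow_nonneg hc 3]
  obtain ⟨t, ht, hGt⟩ := intermediate_value_Icc (by norm_num) hcont ⟨hG1, hG0⟩
  have ht1 : t ∈ Set.Icc (-1 : ℝ) 1 := ⟨ht.1, by linarith [ht.2]⟩
  refine ⟨a + t, ?_, ?_⟩
  · ext x
    simp only [Set.mem_inter_iff, Set.mem_Icc, Set.mem_singleton_iff]
    constructor
    · rintro ⟨hx, hx1, hx2⟩
      have hroot : G (x - a) = 0 := by
        refine (hiff (x - a) (by linarith)).1 ?_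
        rwa [add_sub_cancel]
      have := hmono.injOn (x₁ := x - a) ⟨by linarith, by linarith⟩ ht1 (hroot.trans hGt.symm)
      linarith
    · rintro rfl
      exact ⟨(hiff t (by linarith [ht1.1])).2 hGt, by linarith [ht1.1], by linarith [ht1.2]⟩
  · rw [add_sub_cancel_left, abs_of_nonpos ht.2, le_div_iff₀ (by linarith)]
    have hs : 2 / Real.pi * (-t) ≤ Real.sin (-t) :=
      Real.mul_le_sin (by linarith [ht.2]) (by linarith [ht.1])
    have hs' : 1 / 2 * (-t) ≤ Real.sin (-t) := by
      refine le_trans (mul_le_mul_of_nonneg_right ?_ (by linarith [ht.2])) hs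
      rw [div_le_div_iff₀ (by norm_num) (by linarith)]
      linarith
    rw [Real.sin_neg] at hs'
    have hc : 0 ≤ Real.cos t :=
      Real.cos_nonneg_of_mem_Icc ⟨by linarith [ht.1], by linarith [ht.2]⟩
    have hGt' : 3 * (a + t) * Real.sin t + 3 * Real.cos t - Real.cos t ^ 3 = 0 := hGt
    have hb : 3 * (a + t) * (-Real.sin t) ≤ 3 := by
      linarith [Real.cos_le_one t, pow_nonneg hc 3]
    have hat : 3 * (k : ℝ) ≤ a + t := by linarith [ht.1]
    have : 3 * (k : ℝ) * (1 / 2 * (-t)) ≤ (a + t) * (-Real.sin t) :=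
      mul_le_mul hat hs' (by linarith [ht.2]) (by linarith)
    linarith

end
end

section
/- Let m>0, c>0 and δ>0 be such that |∂_ξ³θ(ξ;m)| ≥ c for all ξ∈(−2δ,2δ). Then there exists C>0 (depending only on m, c, δ) such that for every Schwartz function φ:ℝ→ℂ whose Fourier transform φ̂ is supported in [−δ,δ] and every integer n≥1, sup_{x∈ℝ} |∫_ℝ e^{2inθ(ξ;m)+iξx}·φ̂(ξ)·dξ| ≤ C·n^{−1/3}·‖φ‖_{L¹}, and the same bound holds with the phase −2inθ(ξ;m)+iξx. -/
open MeasureTheory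

noncomputable section

/-- Fourier transform of a scalar function. -/
def FTc (φ : ℝ → ℂ) (ξ : ℝ) : ℂ := ∫ x : ℝ, Complex.exp (-(Complex.I * ξ * x)) * φ x

lemma contDiff_theta {m : ℝ} (hm : 0 < m) : ContDiff ℝ 3 (theta m) := by
  have hω : ContDiff ℝ 3 fun ξ : ℝ => Real.sqrt (m ^ 2 + ξ ^ 2) :=
    ContDiff.sqrt (by fun_prop) fun ξ => by positivity
  have hden : ContDiff ℝ 3 fun ξ : ℝ =>
      Real.sqrt (m ^ 2 + ξ ^ 2 * Real.cos (Real.sqrt (m ^ 2 + ξ ^ 2)) ^ 2) :=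
    ContDiff.sqrt (contDiff_const.add ((contDiff_id.pow 2).mul (hω.cos.pow 2)))
      fun ξ => by positivity
  exact ((contDiff_id.mul hω.sin).div hden fun ξ => by positivity).arctan

lemma hasDerivAt_iteratedDeriv {f : ℝ → ℝ} {n k : ℕ} (hf : ContDiff ℝ n f) (hk : k < n) (x : ℝ) :
    HasDerivAt (iteratedDeriv k f) (iteratedDeriv (k + 1) f x) x := by
  rw [iteratedDeriv_succ]
  exact (hf.differentiable_iteratedDeriv k (by exact_mod_cast hk) x).hasDerivAt

lemma norm_intervalIntegral_exp_I_le (f : ℝ → ℝ) {a b : ℝ} (hab : a ≤ b) :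
    ‖∫ x in a..b, Complex.exp (Complex.I * f x)‖ ≤ b - a := by
  have h := intervalIntegral.norm_integral_le_of_norm_le_const
    (f := fun x => Complex.exp (Complex.I * f x)) (a := a) (b := b) (C := 1)
    fun x _ => (Complex.norm_exp_I_mul_ofReal (f x)).le
  rwa [one_mul, abs_of_nonneg (sub_nonneg.2 hab)] at h

lemma norm_intervalIntegral_exp_neg (f : ℝ → ℝ) (a b : ℝ) :
    ‖∫ x in a..b, Complex.exp (Complex.I * (-f x : ℝ))‖
      = ‖∫ x in a..b, Complex.exp (Complex.I * f x)‖ := by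
  rw [← Complex.norm_conj (∫ x in a..b, Complex.exp (Complex.I * f x))]
  simp only [intervalIntegral, map_sub, ← integral_conj, ← Complex.exp_conj, map_mul,
    Complex.conj_I, Complex.conj_ofReal, Complex.ofReal_neg, mul_neg, neg_mul]

/-- Van der Corput's first derivative test. -/
lemma vanDerCorput_first {f f₁ f₂ : ℝ → ℝ} (hf : ∀ x, HasDerivAt f (f₁ x) x)
    (hf₁ : ∀ x, HasDerivAt f₁ (f₂ x) x) (hf₂ : Continuous f₂) {a b μ : ℝ} (hab : a ≤ b)
    (hμ : 0 < μ) (h₁ : ∀ x ∈ Set.Icc a b, μ ≤ |f₁ x|) (h₂ : ∀ x ∈ Set.Icc a b, 0 ≤ f₂ x) :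
    ‖∫ x in a..b, Complex.exp (Complex.I * f x)‖ ≤ 4 / μ := by
  have cf : Continuous f := continuous_iff_continuousAt.2 fun x => (hf x).continuousAt
  have cf₁ : Continuous f₁ := continuous_iff_continuousAt.2 fun x => (hf₁ x).continuousAt
  have hne : ∀ x ∈ Set.Icc a b, f₁ x ≠ 0 := fun x hx h => by
    have := h₁ x hx
    rw [h, abs_zero] at this
    linarith
  have huIcc : Set.uIcc a b = Set.Icc a b := Set.uIcc_of_le hab
  have hexp : ∀ x, HasDerivAt (fun x => Complex.exp (Complex.I * f x))
      (Complex.exp (Complex.I * f x) * (Complex.I * f₁ x)) x := fun x =>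
    ((hf x).ofReal_comp.const_mul Complex.I).cexp
  have hinv : ∀ x ∈ Set.Icc a b, HasDerivAt (fun x => (f₁ x)⁻¹) (-f₂ x / f₁ x ^ 2) x :=
    fun x hx => (hf₁ x).inv (hne x hx)
  have hcont : ContinuousOn (fun x => -f₂ x / f₁ x ^ 2) (Set.uIcc a b) := by
    rw [huIcc]
    exact hf₂.neg.continuousOn.div (cf₁.pow 2).continuousOn fun x hx => pow_ne_zero 2 (hne x hx)
  have hparts := intervalIntegral.integral_mul_deriv_eq_deriv_mul
    (u := fun x => (((f₁ x)⁻¹ : ℝ) : ℂ)) (u' := fun x => ((-f₂ x / f₁ x ^ 2 : ℝ) : ℂ))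
    (v := fun x => Complex.exp (Complex.I * f x))
    (v' := fun x => Complex.exp (Complex.I * f x) * (Complex.I * f₁ x)) (a := a) (b := b)
    (fun x hx => (hinv x (huIcc ▸ hx)).ofReal_comp) (fun x _ => hexp x)
    (Complex.continuous_ofReal.comp_continuousOn hcont).intervalIntegrable
    (Continuous.intervalIntegrable (by fun_prop) _ _)
  have hleft : (∫ x in a..b, (((f₁ x)⁻¹ : ℝ) : ℂ) *
      (Complex.exp (Complex.I * f x) * (Complex.I * f₁ x)))
      = Complex.I * ∫ x in a..b, Complex.exp (Complex.I * f x) := by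
    rw [← intervalIntegral.integral_const_mul]
    refine intervalIntegral.integral_congr fun x hx => ?_
    have : (f₁ x : ℂ) ≠ 0 := Complex.ofReal_ne_zero.2 (hne x (huIcc ▸ hx))
    simp only [Complex.ofReal_inv]
    field_simp
  have hinvle : ∀ x ∈ Set.Icc a b, |(f₁ x)⁻¹| ≤ 1 / μ := fun x hx => by
    rw [abs_inv, ← one_div]
    exact one_div_le_one_div_of_le hμ (h₁ x hx)
  have hrem : ‖∫ x in a..b, ((-f₂ x / f₁ x ^ 2 : ℝ) : ℂ) * Complex.exp (Complex.I * f x)‖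
      ≤ (f₁ a)⁻¹ - (f₁ b)⁻¹ := by
    have hint := intervalIntegral.integral_eq_sub_of_hasDerivAt
      (fun x hx => hinv x (huIcc ▸ hx)) hcont.intervalIntegrable
    calc _ ≤ ∫ x in a..b, -(-f₂ x / f₁ x ^ 2) := by
          refine intervalIntegral.norm_integral_le_of_norm_le hab ?_ hcont.intervalIntegrable.neg
          refine Filter.Eventually.of_forall fun x hx => ?_
          have hx' := h₂ x (Set.Ioc_subset_Icc_self hx)
          rw [norm_mul, Complex.norm_exp_I_mul_ofReal, mul_one, Complex.norm_real,
            Real.norm_eq_abs, neg_div, abs_neg, neg_neg, abs_of_nonneg (by positivity)]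
      _ = _ := by rw [intervalIntegral.integral_neg, hint]; ring
  rw [hleft] at hparts
  have ha := hinvle a (Set.left_mem_Icc.2 hab)
  have hb := hinvle b (Set.right_mem_Icc.2 hab)
  calc _ = ‖Complex.I * ∫ x in a..b, Complex.exp (Complex.I * f x)‖ := by simp
    _ ≤ |(f₁ b)⁻¹| + |(f₁ a)⁻¹| + ((f₁ a)⁻¹ - (f₁ b)⁻¹) := by
        rw [hparts]
        refine (norm_sub_le _ _).trans (add_le_add ((norm_sub_le _ _).trans_eq ?_) hrem)
        simp only [norm_mul, Complex.norm_exp_I_mul_ofReal, mul_one, Complex.norm_real,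
          Real.norm_eq_abs]
    _ ≤ 1 / μ + 1 / μ + (1 / μ + 1 / μ) := by
        linarith [le_abs_self (f₁ a)⁻¹, neg_abs_le (f₁ b)⁻¹]
    _ = 4 / μ := by ring

/-- A function with derivative at least `μ` on `[a, b]` has linear lower bounds away from
some point of `[a, b]`. -/
lemma exists_linear_growth {g g' : ℝ → ℝ} (hg : ∀ x, HasDerivAt g (g' x) x) {a b μ : ℝ}
    (hab : a ≤ b) (h : ∀ x ∈ Set.Icc a b, μ ≤ g' x) :
    ∃ p ∈ Set.Icc a b, (∀ x ∈ Set.Ioc p b, μ * (x - p) ≤ g x) ∧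
      ∀ x ∈ Set.Ico a p, g x ≤ -(μ * (p - x)) := by
  have cg : Continuous g := continuous_iff_continuousAt.2 fun x => (hg x).continuousAt
  have hmv : ∀ x ∈ Set.Icc a b, ∀ y ∈ Set.Icc a b, x ≤ y → μ * (y - x) ≤ g y - g x :=
    (convex_Icc a b).mul_sub_le_image_sub_of_le_deriv cg.continuousOn
      (fun x _ => (hg x).differentiableAt.differentiableWithinAt)
      fun x hx => (hg x).deriv ▸ h x (interior_subset hx)
  have key : ∃ p ∈ Set.Icc a b, (p = b ∨ 0 ≤ g p) ∧ (p = a ∨ g p ≤ 0) := by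
    by_cases ha : 0 ≤ g a
    · exact ⟨a, Set.left_mem_Icc.2 hab, .inr ha, .inl rfl⟩
    by_cases hb : g b ≤ 0
    · exact ⟨b, Set.right_mem_Icc.2 hab, .inl rfl, .inr hb⟩
    obtain ⟨p, hp, hp0⟩ := intermediate_value_Icc hab cg.continuousOn
      (show (0 : ℝ) ∈ Set.Icc (g a) (g b) from ⟨(not_le.1 ha).le, (not_le.1 hb).le⟩)
    exact ⟨p, hp, .inr hp0.ge, .inr hp0.le⟩
  obtain ⟨p, hp, hpr, hpl⟩ := key
  refine ⟨p, hp, fun x hx => ?_, fun x hx => ?_⟩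
  · have hxp := hmv p hp x ⟨hp.1.trans hx.1.le, hx.2⟩ hx.1.le
    rcases hpr with rfl | hpr
    · exact absurd hx.1 hx.2.not_gt
    · linarith
  · have hxp := hmv x ⟨hx.1, hx.2.le.trans hp.2⟩ p hp hx.2.le
    rcases hpl with rfl | hpl
    · exact absurd hx.2 hx.1.not_gt
    · linarith

/-- Splitting an oscillatory integral at the `η`-neighbourhood of a point. -/
lemma norm_intervalIntegral_exp_le_of_split {f : ℝ → ℝ} (hf : Continuous f) {a b p η K : ℝ}
    (hp : p ∈ Set.Icc a b) (hη : 0 < η) (hK : 0 ≤ K)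
    (hr : p + η ≤ b → ‖∫ x in (p + η)..b, Complex.exp (Complex.I * f x)‖ ≤ K)
    (hl : a ≤ p - η → ‖∫ x in a..(p - η), Complex.exp (Complex.I * f x)‖ ≤ K) :
    ‖∫ x in a..b, Complex.exp (Complex.I * f x)‖ ≤ 2 * η + 2 * K := by
  have hi : ∀ u v, IntervalIntegrable (fun x => Complex.exp (Complex.I * f x)) volume u v :=
    fun u v => Continuous.intervalIntegrable (by fun_prop) u v
  obtain ⟨hap, hpb⟩ := hp
  have hR : ‖∫ x in p..b, Complex.exp (Complex.I * f x)‖ ≤ η + K := by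
    rcases le_total (p + η) b with hb | hb
    · rw [← intervalIntegral.integral_add_adjacent_intervals (hi p (p + η)) (hi _ b)]
      refine (norm_add_le _ _).trans (add_le_add ?_ (hr hb))
      simpa using norm_intervalIntegral_exp_I_le f (show p ≤ p + η by linarith)
    · linarith [norm_intervalIntegral_exp_I_le f hpb]
  have hL : ‖∫ x in a..p, Complex.exp (Complex.I * f x)‖ ≤ K + η := by
    rcases le_total a (p - η) with hb | hb
    · rw [← intervalIntegral.integral_add_adjacent_intervals (hi a (p - η)) (hi _ p)]
      refine (norm_add_le _ _).trans (add_le_add (hl hb) ?_)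
      simpa using norm_intervalIntegral_exp_I_le f (show p - η ≤ p by linarith)
    · linarith [norm_intervalIntegral_exp_I_le f hap]
  rw [← intervalIntegral.integral_add_adjacent_intervals (hi a p) (hi p b)]
  linarith [norm_add_le (∫ x in a..p, Complex.exp (Complex.I * f x))
    (∫ x in p..b, Complex.exp (Complex.I * f x))]

/-- Van der Corput's second derivative test. -/
lemma vanDerCorput_second {f f₁ f₂ : ℝ → ℝ} (hf : ∀ x, HasDerivAt f (f₁ x) x)
    (hf₁ : ∀ x, HasDerivAt f₁ (f₂ x) x) (hf₂ : Continuous f₂) {a b μ : ℝ} (hab : a ≤ b)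
    (hμ : 0 < μ) (h₂ : ∀ x ∈ Set.Icc a b, μ ≤ f₂ x) :
    ‖∫ x in a..b, Complex.exp (Complex.I * f x)‖ ≤ 10 * μ ^ (-(1 / 2) : ℝ) := by
  have cf : Continuous f := continuous_iff_continuousAt.2 fun x => (hf x).continuousAt
  obtain ⟨p, hp, hr, hl⟩ := exists_linear_growth hf₁ hab h₂
  set η : ℝ := μ ^ (-(1 / 2) : ℝ)
  have hη : 0 < η := Real.rpow_pos_of_pos hμ _
  have hημ : μ * η * η = 1 := by
    rw [mul_assoc, ← Real.rpow_add hμ, show (-(1 / 2) + -(1 / 2) : ℝ) = -1 by norm_num,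
      Real.rpow_neg_one, mul_inv_cancel₀ hμ.ne']
  have hK : 4 / (μ * η) = 4 * η := by
    field_simp
    linarith
  have := norm_intervalIntegral_exp_le_of_split cf hp hη (K := 4 / (μ * η)) (by positivity)
    (fun hb => vanDerCorput_first hf hf₁ hf₂ hb (by positivity)
      (fun x hx => ?_)
      fun x hx => hμ.le.trans (h₂ x ⟨by linarith [hp.1, hx.1], hx.2⟩))
    (fun hb => vanDerCorput_first hf hf₁ hf₂ hb (by positivity)
      (fun x hx => ?_)
      fun x hx => hμ.le.trans (h₂ x ⟨hx.1, by linarith [hp.2, hx.2]⟩))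
  · linarith
  · refine le_trans ?_ (le_abs_self _)
    have h1 := hr x ⟨by linarith [hx.1], hx.2⟩
    have h2 : μ * η ≤ μ * (x - p) := mul_le_mul_of_nonneg_left (by linarith [hx.1]) hμ.le
    linarith
  · refine le_trans ?_ (neg_le_abs _)
    have h1 := hl x ⟨hx.1, by linarith [hx.2]⟩
    have h2 : μ * η ≤ μ * (p - x) := mul_le_mul_of_nonneg_left (by linarith [hx.2]) hμ.le
    linarith

/-- Van der Corput's third derivative test, for a positive third derivative. -/
lemma vanDerCorput_third_of_pos {f f₁ f₂ f₃ : ℝ → ℝ} (hf : ∀ x, HasDerivAt f (f₁ x) x)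
    (hf₁ : ∀ x, HasDerivAt f₁ (f₂ x) x) (hf₂ : ∀ x, HasDerivAt f₂ (f₃ x) x) {a b μ : ℝ}
    (hab : a ≤ b) (hμ : 0 < μ) (h₃ : ∀ x ∈ Set.Icc a b, μ ≤ f₃ x) :
    ‖∫ x in a..b, Complex.exp (Complex.I * f x)‖ ≤ 22 * μ ^ (-(1 / 3) : ℝ) := by
  have cf : Continuous f := continuous_iff_continuousAt.2 fun x => (hf x).continuousAt
  have cf₂ : Continuous f₂ := continuous_iff_continuousAt.2 fun x => (hf₂ x).continuousAt
  obtain ⟨p, hp, hr, hl⟩ := exists_linear_growth hf₂ hab h₃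
  set η : ℝ := μ ^ (-(1 / 3) : ℝ) with hη_def
  have hη : 0 < η := Real.rpow_pos_of_pos hμ _
  have hK : (μ * η) ^ (-(1 / 2) : ℝ) = η := by
    rw [hη_def, ← Real.rpow_one_add' hμ.le (by norm_num), ← Real.rpow_mul hμ.le]
    norm_num
  have := norm_intervalIntegral_exp_le_of_split cf hp hη (K := 10 * (μ * η) ^ (-(1 / 2) : ℝ))
    (by positivity)
    (fun hb => vanDerCorput_second hf hf₁ cf₂ hb (by positivity) fun x hx => ?_)
    (fun hb => norm_intervalIntegral_exp_neg f a _ ▸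
      vanDerCorput_second (fun x => (hf x).neg) (fun x => (hf₁ x).neg) cf₂.neg hb (by positivity)
      fun x hx => ?_)
  · linarith
  · have h1 := hr x ⟨by linarith [hx.1], hx.2⟩
    have h2 : μ * η ≤ μ * (x - p) := mul_le_mul_of_nonneg_left (by linarith [hx.1]) hμ.le
    linarith
  · have h1 := hl x ⟨hx.1, by linarith [hx.2]⟩
    have h2 : μ * η ≤ μ * (p - x) := mul_le_mul_of_nonneg_left (by linarith [hx.2]) hμ.le
    linarith

/-- Van der Corput's third derivative test. -/
lemma vanDerCorput_third {f f₁ f₂ f₃ : ℝ → ℝ} (hf : ∀ x, HasDerivAt f (f₁ x) x)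
    (hf₁ : ∀ x, HasDerivAt f₁ (f₂ x) x) (hf₂ : ∀ x, HasDerivAt f₂ (f₃ x) x)
    (hf₃ : Continuous f₃) {a b μ : ℝ}
    (hab : a ≤ b) (hμ : 0 < μ) (h₃ : ∀ x ∈ Set.Icc a b, μ ≤ |f₃ x|) :
    ‖∫ x in a..b, Complex.exp (Complex.I * f x)‖ ≤ 22 * μ ^ (-(1 / 3) : ℝ) := by
  have hne : ∀ x ∈ Set.Icc a b, f₃ x ≠ 0 := fun x hx h => by
    have := h₃ x hx
    rw [h, abs_zero] at this
    linarith
  have hsign : (∀ x ∈ Set.Icc a b, 0 < f₃ x) ∨ ∀ x ∈ Set.Icc a b, f₃ x < 0 := by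
    by_contra! H
    obtain ⟨⟨x, hx, hx0⟩, y, hy, hy0⟩ := H
    obtain ⟨z, hz, hz0⟩ := isPreconnected_Icc.intermediate_value hx hy hf₃.continuousOn
      (show (0 : ℝ) ∈ Set.Icc (f₃ x) (f₃ y) from ⟨hx0, hy0⟩)
    exact hne z hz hz0
  rcases hsign with hs | hs
  · exact vanDerCorput_third_of_pos hf hf₁ hf₂ hab hμ fun x hx =>
      (h₃ x hx).trans_eq (abs_of_pos (hs x hx))
  · rw [← norm_intervalIntegral_exp_neg]
    exact vanDerCorput_third_of_pos (fun x => (hf x).neg) (fun x => (hf₁ x).neg)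
      (fun x => (hf₂ x).neg) hab hμ fun x hx => (h₃ x hx).trans_eq (abs_of_neg (hs x hx))

/-- An oscillatory integral against a band-limited Fourier transform is controlled by the
oscillatory integrals over the band with linearly perturbed phases. -/
lemma norm_integral_exp_mul_FTc_le {φ : ℝ → ℂ} (hφ : Integrable φ) {δ B : ℝ} (hδ : 0 ≤ δ)
    (hsupp : Function.support (FTc φ) ⊆ Set.Icc (-δ) δ) {g : ℝ → ℝ} (hg : Continuous g)
    (hB : ∀ y : ℝ, ‖∫ ξ in (-δ)..δ, Complex.exp (Complex.I * (g ξ + y * ξ : ℝ))‖ ≤ B) (x : ℝ) :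
    ‖∫ ξ : ℝ, Complex.exp (Complex.I * g ξ + Complex.I * ξ * x) * FTc φ ξ‖
      ≤ B * ∫ y : ℝ, ‖φ y‖ := by
  have hle : -δ ≤ δ := by linarith
  have hset : (∫ ξ : ℝ, Complex.exp (Complex.I * g ξ + Complex.I * ξ * x) * FTc φ ξ)
      = ∫ ξ in Set.Ioc (-δ) δ, ∫ y : ℝ,
          Complex.exp (Complex.I * (g ξ + (x - y) * ξ : ℝ)) * φ y := by
    rw [← integral_Icc_eq_integral_Ioc, ← setIntegral_eq_integral_of_forall_compl_eq_zero
      (s := Set.Icc (-δ) δ)]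
    · refine integral_congr_ae (Filter.Eventually.of_forall fun ξ => ?_)
      simp only [FTc]
      rw [← integral_const_mul]
      refine integral_congr_ae (Filter.Eventually.of_forall fun y => ?_)
      simp only
      rw [← mul_assoc, ← Complex.exp_add]
      congr 2
      push_cast
      ring
    · intro ξ hξ
      rw [Function.notMem_support.1 fun h => hξ (hsupp h), mul_zero]
  have hint : Integrable (Function.uncurry fun ξ y : ℝ =>
      Complex.exp (Complex.I * (g ξ + (x - y) * ξ : ℝ)) * φ y)
      ((volume.restrict (Set.Ioc (-δ) δ)).prod volume) := by
    have hφ' := hφ.comp_snd (volume.restrict (Set.Ioc (-δ) δ))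
    refine hφ'.bdd_mul (c := 1) ?_ ?_
    · exact Continuous.aestronglyMeasurable (by fun_prop)
    · exact Filter.Eventually.of_forall fun z => (Complex.norm_exp_I_mul_ofReal _).le
  rw [hset, integral_integral_swap hint, ← integral_const_mul]
  refine norm_integral_le_of_norm_le (hφ.norm.const_mul B)
    (Filter.Eventually.of_forall fun y => ?_)
  rw [integral_mul_const, norm_mul, ← intervalIntegral.integral_of_le hle]
  exact mul_le_mul_of_nonneg_right (hB (x - y)) (norm_nonneg _)

lemma norm_intervalIntegral_exp_theta_le {m c δ : ℝ} (hm : 0 < m) (hc : 0 < c) (hδ : 0 < δ)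
    (h : ∀ ξ ∈ Set.Ioo (-(2 * δ)) (2 * δ), c ≤ |iteratedDeriv 3 (theta m) ξ|)
    {s : ℝ} (hs : s ≠ 0) (y : ℝ) :
    ‖∫ ξ in (-δ)..δ, Complex.exp (Complex.I * (s * theta m ξ + y * ξ : ℝ))‖
      ≤ 22 * (|s| * c) ^ (-(1 / 3) : ℝ) := by
  have hθ : ContDiff ℝ (3 : ℕ) (theta m) := contDiff_theta hm
  have h₁ : ∀ x, HasDerivAt (theta m) (iteratedDeriv 1 (theta m) x) x := fun x => by
    simpa using hasDerivAt_iteratedDeriv hθ (k := 0) (by norm_num) x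
  refine vanDerCorput_third (f₁ := fun ξ => s * iteratedDeriv 1 (theta m) ξ + y)
    (f₂ := fun ξ => s * iteratedDeriv 2 (theta m) ξ)
    (f₃ := fun ξ => s * iteratedDeriv 3 (theta m) ξ)
    (fun x => ?_)
    (fun x => ((hasDerivAt_iteratedDeriv hθ (by norm_num) x).const_mul s).add_const y)
    (fun x => (hasDerivAt_iteratedDeriv hθ (by norm_num) x).const_mul s)
    (continuous_const.mul (hθ.continuous_iteratedDeriv 3 le_rfl))
    (by linarith) (by positivity) fun x hx => ?_
  · simpa using ((h₁ x).const_mul s).fun_add ((hasDerivAt_id x).const_mul y)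
  · rw [abs_mul]
    exact mul_le_mul_of_nonneg_left (h x ⟨by linarith [hx.1], by linarith [hx.2]⟩) (abs_nonneg s)

theorem oscillatory_integral_decay (m c δ : ℝ) (hm : 0 < m) (hc : 0 < c) (hδ : 0 < δ)
    (h : ∀ ξ ∈ Set.Ioo (-(2 * δ)) (2 * δ), c ≤ |iteratedDeriv 3 (theta m) ξ|) :
    ∃ C > 0, ∀ φ : SchwartzMap ℝ ℂ,
      Function.support (FTc ⇑φ) ⊆ Set.Icc (-δ) δ →
      ∀ n : ℕ, 1 ≤ n →
        (∀ x : ℝ,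
          ‖∫ ξ : ℝ, Complex.exp (2 * Complex.I * n * theta m ξ + Complex.I * ξ * x) * FTc (⇑φ) ξ‖
            ≤ C * (n : ℝ) ^ (-(1 / 3 : ℝ)) * ∫ y : ℝ, ‖φ y‖) ∧
        (∀ x : ℝ,
          ‖∫ ξ : ℝ, Complex.exp (-(2 * Complex.I * n * theta m ξ) + Complex.I * ξ * x) * FTc (⇑φ) ξ‖
            ≤ C * (n : ℝ) ^ (-(1 / 3 : ℝ)) * ∫ y : ℝ, ‖φ y‖) := by
  refine ⟨22 * (2 * c) ^ (-(1 / 3) : ℝ), by positivity, fun φ hφ n hn => ?_⟩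
  have hn' : (0 : ℝ) < n := by exact_mod_cast hn
  have key : ∀ s : ℝ, |s| = 2 * n → ∀ x : ℝ,
      ‖∫ ξ : ℝ, Complex.exp (Complex.I * (s * theta m ξ : ℝ) + Complex.I * ξ * x) * FTc (⇑φ) ξ‖
        ≤ 22 * (2 * c) ^ (-(1 / 3) : ℝ) * (n : ℝ) ^ (-(1 / 3 : ℝ)) * ∫ y : ℝ, ‖φ y‖ := by
    intro s hs
    refine norm_integral_exp_mul_FTc_le φ.integrable hδ.le hφ
      (continuous_const.mul (contDiff_theta hm).continuous) fun y => ?_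
    have hs0 : s ≠ 0 := abs_pos.1 (hs ▸ by positivity)
    refine (norm_intervalIntegral_exp_theta_le hm hc hδ h hs0 y).trans_eq ?_
    rw [hs, mul_assoc 22, ← Real.mul_rpow (by positivity) hn'.le]
    ring_nf
  refine ⟨fun x => ?_, fun x => ?_⟩
  · convert key (2 * n) (abs_of_pos (by positivity)) x using 6
    push_cast
    ring
  · convert key (-(2 * n)) (by rw [abs_neg, abs_of_pos (by positivity)]) x using 6
    push_cast
    ring

end
end
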